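/- For every ρ ≥ 1 there exists a constant C depending only on ρ such that the following holds. Let T ⊂ ℝ³ be a nondegenerate tetrahedron with vertices p₀, p₁, p₂, p₃, diameter h and inradius r satisfying h/r ≤ ρ. For each i let σᵢ be an edge of T having pᵢ as an endpoint, and define the quasi-interpolant Du = Σᵢ (Π_{σᵢ}u)(pᵢ) λᵢ, where λᵢ are the barycentric coordinates of T. Then for every u twice continuously differentiable on a neighborhood of the closure of T: |Du|_{H¹(T)} ≤ C h⁻¹ ( ‖u‖_{L²(T)} + h |u|_{H¹(T)} + h² |u|_{H²(T)} ). -/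

import Mathlib

open MeasureTheory Set

noncomputable section

/-- The inradius of a set `T ⊆ ℝ³`: the supremum of radii of closed balls
contained in `T`. -/
def inradius (T : Set (EuclideanSpace ℝ (Fin 3))) : ℝ :=
  sSup {s : ℝ | ∃ c, Metric.closedBall c s ⊆ T}

/-- The `L²` norm of `u` on `T`. -/
def L2norm (T : Set (EuclideanSpace ℝ (Fin 3))) (u : EuclideanSpace ℝ (Fin 3) → ℝ) : ℝ :=
  Real.sqrt (∫ x in T, (u x) ^ 2)

/-- The `H¹(T)` seminorm `|u|_{H¹(T)} = (Σ_{|α|=1} ∫_T |∂^α u|²)^{1/2}`. -/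
def H1seminorm (T : Set (EuclideanSpace ℝ (Fin 3)))
    (u : EuclideanSpace ℝ (Fin 3) → ℝ) : ℝ :=
  Real.sqrt (∑ i : Fin 3, ∫ x in T, (fderiv ℝ u x (EuclideanSpace.single i 1)) ^ 2)

/-- The `H²(T)` seminorm `|u|_{H²(T)} = (Σ_{|α|=2} ∫_T |∂^α u|²)^{1/2}`. -/
def H2seminorm (T : Set (EuclideanSpace ℝ (Fin 3)))
    (u : EuclideanSpace ℝ (Fin 3) → ℝ) : ℝ :=
  Real.sqrt (∑ i : Fin 3, ∑ j : Fin 3, ∫ x in T,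
    (iteratedFDeriv ℝ 2 u x
      ![EuclideanSpace.single i 1, EuclideanSpace.single j 1]) ^ 2)


/-- The integral along a segment of unit direction, in arclength parametrization. -/
lemma setIntegral_segment_hausdorffMeasure {E : Type*} [NormedAddCommGroup E] [NormedSpace ℝ E]
    [MeasurableSpace E] [BorelSpace E] (p w : E) (hw : ‖w‖ = 1) {L : ℝ} (hL : 0 ≤ L) (f : E → ℝ) :
    ∫ x in segment ℝ p (p + L • w), f x ∂μH[1] = ∫ t in (0 : ℝ)..L, f (p + t • w) := by
  have hiso : Isometry (fun t : ℝ => p + t • w) := by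
    refine Isometry.of_dist_eq fun s t => ?_
    rw [dist_add_left, dist_eq_norm, ← sub_smul, norm_smul, hw, mul_one, Real.dist_eq,
      Real.norm_eq_abs]
  have hseg : segment ℝ p (p + L • w) = (fun t : ℝ => p + t • w) '' Icc 0 L := by
    rw [segment_eq_image', add_sub_cancel_left]
    ext x
    simp only [mem_image, mem_Icc]
    constructor
    · rintro ⟨θ, ⟨h0, h1⟩, rfl⟩
      exact ⟨θ * L, ⟨by positivity, by nlinarith⟩, by rw [mul_smul]⟩
    · rintro ⟨t, ⟨h0, h1⟩, rfl⟩
      rcases hL.eq_or_lt with h | h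
      · obtain rfl : t = 0 := by linarith
        exact ⟨0, by simp, by simp⟩
      · exact ⟨t / L, ⟨by positivity, (div_le_one h).2 h1⟩, by
          rw [smul_smul, div_mul_cancel₀ _ h.ne']⟩
  rw [hseg, intervalIntegral.integral_of_le hL, ← integral_Icc_eq_integral_Ioc]
  have hmap := hiso.map_hausdorffMeasure (d := 1) (Or.inl zero_le_one)
  rw [← hausdorffMeasure_real]
  have hemb := hiso.isClosedEmbedding
  have h := hemb.setIntegral_map (μ := (μH[1] : Measure ℝ)) (f := f)
    ((fun t : ℝ => p + t • w) '' Icc 0 L)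
  rw [preimage_image_eq _ hiso.injective, hmap, Measure.restrict_restrict,
    inter_eq_left.2 (image_subset_range _ _)] at h
  · exact h
  · exact hemb.measurableEmbedding.measurableSet_image.2 measurableSet_Icc

/-- The `L²` projection of `u` onto affine functions along an edge, evaluated at an endpoint, is
controlled by the maximum of `|u|` on the edge. -/
lemma abs_le_of_segment_leastSquares {E : Type*} [NormedAddCommGroup E] [NormedSpace ℝ E]
    [MeasurableSpace E] [BorelSpace E] {p q : E} (hpq : q ≠ p) {u : E → ℝ} {M : ℝ} (hM0 : 0 ≤ M)
    (hu : ContinuousOn u (segment ℝ p q)) (hM : ∀ x ∈ segment ℝ p q, |u x| ≤ M) (g : E →ᵃ[ℝ] ℝ)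
    (hg : ∫ x in segment ℝ p q, (u x - g x) ^ 2 ∂μH[1] ≤
      ∫ x in segment ℝ p q, (u x - (0 : E →ᵃ[ℝ] ℝ) x) ^ 2 ∂μH[1]) :
    |g p| ≤ 4 * M := by
  set L := ‖q - p‖ with hLdef
  have hL : 0 < L := norm_pos_iff.2 (sub_ne_zero.2 hpq)
  set w : E := L⁻¹ • (q - p) with hwdef
  have hw : ‖w‖ = 1 := by
    rw [hwdef, norm_smul, norm_inv, Real.norm_of_nonneg hL.le, inv_mul_cancel₀ hL.ne']
  have hq : q = p + L • w := by rw [hwdef, smul_inv_smul₀ hL.ne', add_sub_cancel]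
  have hmem : ∀ t ∈ Icc 0 L, p + t • w ∈ segment ℝ p q := by
    intro t ht
    rw [segment_eq_image']
    exact ⟨t / L, ⟨by have := ht.1; positivity, (div_le_one hL).2 ht.2⟩, by
      simp only [hwdef, smul_smul, div_eq_mul_inv]⟩
  have hgt : ∀ t : ℝ, g (p + t • w) = g p + g.linear w * t := by
    intro t
    rw [add_comm p, ← vadd_eq_add, g.map_vadd, map_smul, vadd_eq_add, smul_eq_mul]; ring
  set a := g p
  set b := g.linear w
  have hcont : ContinuousOn (fun t : ℝ => u (p + t • w)) (uIcc 0 L) := by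
    rw [uIcc_of_le hL.le]
    exact hu.comp (by fun_prop) hmem
  rw [hq, setIntegral_segment_hausdorffMeasure p w hw hL.le,
    setIntegral_segment_hausdorffMeasure p w hw hL.le] at hg
  simp only [hgt, AffineMap.coe_zero, Pi.zero_apply, sub_zero] at hg
  have hi1 : IntervalIntegrable (fun t : ℝ => (u (p + t • w) - (a + b * t)) ^ 2) volume 0 L :=
    ((hcont.sub (by fun_prop)).pow 2).intervalIntegrable
  have hi2 : IntervalIntegrable (fun t : ℝ => u (p + t • w) ^ 2) volume 0 L :=
    (hcont.pow 2).intervalIntegrable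
  have hsq : ∫ t in (0 : ℝ)..L, u (p + t • w) ^ 2 ≤ M ^ 2 * L := by
    have := intervalIntegral.integral_mono_on hL.le hi2 (g := fun _ => M ^ 2) (by simp)
      (fun t ht => sq_le_sq' (abs_le.1 (hM _ (hmem t ht))).1 (abs_le.1 (hM _ (hmem t ht))).2)
    simpa [mul_comm] using this
  have hsum : ∫ t in (0 : ℝ)..L, (a + b * t) ^ 2 ≤
      ∫ t in (0 : ℝ)..L, (2 * (u (p + t • w) - (a + b * t)) ^ 2 + 2 * u (p + t • w) ^ 2) := by
    refine intervalIntegral.integral_mono_on hL.le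
      (Continuous.intervalIntegrable (by fun_prop) _ _)
      ((hi1.const_mul 2).add (hi2.const_mul 2)) fun t _ => ?_
    nlinarith [sq_nonneg (u (p + t • w) - (a + b * t) + u (p + t • w))]
  rw [intervalIntegral.integral_add (hi1.const_mul 2) (hi2.const_mul 2),
    intervalIntegral.integral_const_mul, intervalIntegral.integral_const_mul] at hsum
  have hval : ∫ t in (0 : ℝ)..L, (a + b * t) ^ 2 = a ^ 2 * L + a * b * L ^ 2 + b ^ 2 * L ^ 3 / 3 := by
    have hd : ∀ t ∈ uIcc 0 L, HasDerivAt
        (fun t : ℝ => a ^ 2 * t + a * b * t ^ 2 + b ^ 2 * t ^ 3 / 3) ((a + b * t) ^ 2) t := by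
      intro t _
      have := (((hasDerivAt_id t).const_mul (a ^ 2)).add
        (((hasDerivAt_id t).pow 2).const_mul (a * b))).add
        ((((hasDerivAt_id t).pow 3).const_mul (b ^ 2)).div_const 3)
      refine (this.congr_deriv ?_)
      simp only [id]; push_cast; ring
    rw [intervalIntegral.integral_eq_sub_of_hasDerivAt hd
      (Continuous.intervalIntegrable (by fun_prop) _ _)]
    ring
  have key : a ^ 2 * L ≤ (4 * M) ^ 2 * L := by
    have : 0 ≤ (3 * a + 2 * b * L) ^ 2 * L := by positivity
    nlinarith
  exact abs_le_of_sq_le_sq (le_of_mul_le_mul_right key hL) (by positivity)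

/-- Cauchy–Schwarz against the constant function. -/
lemma setIntegral_le_sqrt_mul_sqrt {α : Type*} [MeasurableSpace α] {μ : Measure α} {s : Set α}
    (hs : μ s ≠ ⊤) {f : α → ℝ} (hf : IntegrableOn f s μ)
    (hf2 : IntegrableOn (fun x => f x ^ 2) s μ) :
    ∫ x in s, f x ∂μ ≤ √(μ.real s) * √(∫ x in s, f x ^ 2 ∂μ) := by
  rw [← Real.sqrt_mul measureReal_nonneg]
  apply Real.le_sqrt_of_sq_le
  set V := μ.real s
  set I := ∫ x in s, f x ∂μ with hI
  have hV : 0 ≤ V := measureReal_nonneg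
  rcases hV.eq_or_lt with h | h
  · have hs0 : μ s = 0 := by
      rcases (ENNReal.toReal_eq_zero_iff _).1 h.symm with h | h
      exacts [h, absurd h hs]
    have : I = 0 := by rw [hI, Measure.restrict_eq_zero.2 hs0, integral_zero_measure]
    rw [this, ← h]; simp
  · have h0 : 0 ≤ ∫ x in s, (V * f x - I) ^ 2 ∂μ := integral_nonneg fun x => sq_nonneg _
    have hc : IntegrableOn (fun _ => I ^ 2) s μ := integrableOn_const hs
    have heq : ∫ x in s, (V * f x - I) ^ 2 ∂μ =
        V ^ 2 * (∫ x in s, f x ^ 2 ∂μ) - 2 * V * I * I + V * I ^ 2 := by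
      have : ∀ x, (V * f x - I) ^ 2 = V ^ 2 * f x ^ 2 - 2 * V * I * f x + I ^ 2 := by
        intro x; ring
      simp_rw [this]
      have hi : IntegrableOn (fun x => V ^ 2 * f x ^ 2 - 2 * V * I * f x) s μ :=
        (hf2.const_mul (V ^ 2)).sub (hf.const_mul (2 * V * I))
      rw [integral_add hi hc,
        integral_sub (hf2.const_mul _) (hf.const_mul _), integral_const_mul, integral_const_mul,
        setIntegral_const, smul_eq_mul]
    rw [heq] at h0
    have : 0 ≤ V * (V * (∫ x in s, f x ^ 2 ∂μ) - I ^ 2) := by nlinarith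
    linarith [nonneg_of_mul_nonneg_right this h]

/-- Cauchy–Schwarz for the quadratic form of a bilinear form in the standard basis. -/
lemma abs_apply_apply_le_sqrt_sum_sq_mul {ι : Type*} [Fintype ι] [DecidableEq ι]
    (A : EuclideanSpace ℝ ι →L[ℝ] EuclideanSpace ℝ ι →L[ℝ] ℝ) (v : EuclideanSpace ℝ ι) :
    |A v v| ≤ √(∑ i, ∑ j, A (EuclideanSpace.single i 1) (EuclideanSpace.single j 1) ^ 2) *
      ‖v‖ ^ 2 := by
  have hv : v = ∑ i, v i • EuclideanSpace.single i (1 : ℝ) := by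
    have := (EuclideanSpace.basisFun ι ℝ).sum_repr v
    simpa using this.symm
  have hA : A v v = ∑ x : ι × ι, A (EuclideanSpace.single x.1 1) (EuclideanSpace.single x.2 1) *
      (v x.1 * v x.2) := by
    conv_lhs => rw [hv]
    simp only [map_sum, map_smul, sum_apply, smul_apply,
      smul_eq_mul, Finset.mul_sum]
    rw [Finset.sum_comm, Fintype.sum_prod_type]
    refine Finset.sum_congr rfl fun i _ => Finset.sum_congr rfl fun j _ => ?_
    ring
  have hn : ∑ x : ι × ι, (v x.1 * v x.2) ^ 2 = (‖v‖ ^ 2) ^ 2 := by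
    rw [EuclideanSpace.norm_sq_eq, Fintype.sum_prod_type, sq (∑ i, ‖v i‖ ^ 2), Finset.sum_mul_sum]
    simp [mul_pow]
  rw [← Fintype.sum_prod_type (f := fun x : ι × ι =>
    A (EuclideanSpace.single x.1 1) (EuclideanSpace.single x.2 1) ^ 2)]
  refine abs_le_of_sq_le_sq ?_ (by positivity)
  rw [mul_pow, Real.sq_sqrt (Finset.sum_nonneg fun _ _ => sq_nonneg _), ← hn, hA]
  exact Finset.sum_mul_sq_le_sq_mul_sq _ _ _

/-- Cauchy–Schwarz for a linear form in the standard basis. -/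
lemma abs_apply_le_sqrt_sum_sq_mul {ι : Type*} [Fintype ι] [DecidableEq ι]
    (A : EuclideanSpace ℝ ι →L[ℝ] ℝ) (v : EuclideanSpace ℝ ι) :
    |A v| ≤ √(∑ i, A (EuclideanSpace.single i 1) ^ 2) * ‖v‖ := by
  have hv : v = ∑ i, v i • EuclideanSpace.single i (1 : ℝ) := by
    have := (EuclideanSpace.basisFun ι ℝ).sum_repr v
    simpa using this.symm
  have hA : A v = ∑ i, A (EuclideanSpace.single i 1) * v i := by
    conv_lhs => rw [hv]
    simp only [map_sum, map_smul, smul_eq_mul, mul_comm]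
  refine abs_le_of_sq_le_sq ?_ (by positivity)
  rw [mul_pow, Real.sq_sqrt (Finset.sum_nonneg fun _ _ => sq_nonneg _), EuclideanSpace.norm_sq_eq,
    hA]
  simpa using Finset.sum_mul_sq_le_sq_mul_sq Finset.univ
    (fun i => A (EuclideanSpace.single i 1)) (fun i => v i)

/-- Taylor's formula with integral remainder, expanding around the far endpoint. -/
lemma ContDiffOn.eq_sub_add_integral_fderiv_fderiv {E : Type*} [NormedAddCommGroup E]
    [NormedSpace ℝ E] {u : E → ℝ} {U : Set E} (hU : IsOpen U) (hu : ContDiffOn ℝ 2 u U) {x y : E}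
    (hxy : ∀ t ∈ Icc (0 : ℝ) 1, x + t • (y - x) ∈ U) :
    u x = u y - fderiv ℝ u y (y - x) +
      ∫ t in (0 : ℝ)..1, t * fderiv ℝ (fderiv ℝ u) (x + t • (y - x)) (y - x) (y - x) := by
  set v := y - x
  have hu1 : ContDiffOn ℝ 1 (fderiv ℝ u) U := hu.fderiv_of_isOpen hU (by norm_num)
  have hu2 : ContinuousOn (fderiv ℝ (fderiv ℝ u)) U :=
    hu1.continuousOn_fderiv_of_isOpen hU le_rfl
  have hline : ∀ t : ℝ, HasDerivAt (fun t : ℝ => x + t • v) v t := fun t => by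
    simpa using ((hasDerivAt_id t).smul_const v).const_add x
  have hG : ∀ t ∈ uIcc (0 : ℝ) 1, HasDerivAt
      (fun t : ℝ => t * fderiv ℝ u (x + t • v) v - u (x + t • v))
      (t * fderiv ℝ (fderiv ℝ u) (x + t • v) v v) t := by
    intro t ht
    rw [uIcc_of_le zero_le_one] at ht
    have hn := hU.mem_nhds (hxy t ht)
    have h1 : HasDerivAt (fun t : ℝ => u (x + t • v)) (fderiv ℝ u (x + t • v) v) t :=
      ((hu.differentiableOn (by norm_num)).differentiableAt hn).hasFDerivAt.comp_hasDerivAt t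
        (hline t)
    have h2 : HasDerivAt (fun t : ℝ => fderiv ℝ u (x + t • v))
        (fderiv ℝ (fderiv ℝ u) (x + t • v) v) t :=
      ((hu1.differentiableOn (by norm_num)).differentiableAt hn).hasFDerivAt.comp_hasDerivAt t
        (hline t)
    have h3 : HasDerivAt (fun t : ℝ => fderiv ℝ u (x + t • v) v)
        (fderiv ℝ (fderiv ℝ u) (x + t • v) v v) t := by
      simpa using h2.clm_apply (hasDerivAt_const t v)
    refine (((hasDerivAt_id t).mul h3).sub h1).congr_deriv ?_
    simp
  have hc : ContinuousOn (fun t : ℝ => t * fderiv ℝ (fderiv ℝ u) (x + t • v) v v)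
      (uIcc (0 : ℝ) 1) := by
    rw [uIcc_of_le zero_le_one]
    have h : ContinuousOn (fun t : ℝ => fderiv ℝ (fderiv ℝ u) (x + t • v)) (Icc 0 1) :=
      hu2.comp (by fun_prop) hxy
    exact continuousOn_id.mul ((h.clm_apply continuousOn_const).clm_apply continuousOn_const)
  rw [intervalIntegral.integral_eq_sub_of_hasDerivAt hG hc.intervalIntegrable]
  simp only [v, one_mul, one_smul, zero_mul, zero_smul, add_zero, add_sub_cancel]
  ring

/-- Change of variables for the contraction of `B` towards a point of a convex set `T`. -/
lemma setIntegral_comp_add_smul_sub_le {E : Type*} [NormedAddCommGroup E] [NormedSpace ℝ E]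
    [FiniteDimensional ℝ E] [MeasurableSpace E] [BorelSpace E] {μ : Measure E} [μ.IsAddHaarMeasure]
    {T B : Set E} (hT : MeasurableSet T) (hB : MeasurableSet B) {f : E → ℝ} (hf : IntegrableOn f T μ)
    (hf0 : ∀ z, 0 ≤ f z) {x : E} {t : ℝ} (ht : 0 < t) (hmaps : ∀ y ∈ B, x + t • (y - x) ∈ T) :
    ∫ y in B, f (x + t • (y - x)) ∂μ ≤ (t ^ Module.finrank ℝ E)⁻¹ * ∫ z in T, f z ∂μ := by
  set F : E → ℝ := T.indicator f
  have hF0 : ∀ z, 0 ≤ F z := indicator_nonneg fun z _ => hf0 z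
  have hFi : Integrable F μ := (integrable_indicator_iff hT).2 hf
  have hFi' : Integrable (fun y => F ((x - t • x) + t • y)) μ :=
    (hFi.comp_add_left (x - t • x)).comp_smul ht.ne'
  have hpt : ∀ y, x + t • (y - x) = (x - t • x) + t • y := fun y => by rw [smul_sub]; abel
  calc ∫ y in B, f (x + t • (y - x)) ∂μ
      = ∫ y in B, F ((x - t • x) + t • y) ∂μ := by
        refine setIntegral_congr_fun hB fun y hy => ?_
        have h := hmaps y hy
        simp only [F]
        rw [← hpt, indicator_of_mem h]
    _ ≤ ∫ y, F ((x - t • x) + t • y) ∂μ :=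
        setIntegral_le_integral hFi' (Filter.Eventually.of_forall fun y => hF0 _)
    _ = (t ^ Module.finrank ℝ E)⁻¹ * ∫ z in T, f z ∂μ := by
        rw [Measure.integral_comp_smul_of_nonneg μ (fun z => F ((x - t • x) + z)) t (hR := ht.le),
          integral_add_left_eq_self, integral_indicator hT, smul_eq_mul]

/-- The weighted integral of a function over the cone with apex `x` and base a ball is controlled
by its `L²` norm; the weight `t` makes the apex singularity integrable in dimension three. -/
lemma integral_integral_cone_le {T : Set (EuclideanSpace ℝ (Fin 3))} (hTc : IsCompact T)
    (hTconv : Convex ℝ T) {f : EuclideanSpace ℝ (Fin 3) → ℝ} (hf : ContinuousOn f T)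
    {B : Set (EuclideanSpace ℝ (Fin 3))} (hBc : IsCompact B) (hBT : B ⊆ T)
    {x : EuclideanSpace ℝ (Fin 3)} (hx : x ∈ T) :
    IntegrableOn (fun y => ∫ t in (0 : ℝ)..1, t * f (x + t • (y - x))) B ∧
    ∫ y in B, (∫ t in (0 : ℝ)..1, t * f (x + t • (y - x))) ≤
      2 * (√(volume.real B) * √(∫ z in T, f z ^ 2)) := by
  have hmaps : ∀ t ∈ Icc (0 : ℝ) 1, ∀ y ∈ B, x + t • (y - x) ∈ T := fun t ht y hy =>
    hTconv.add_smul_sub_mem hx (hBT hy) ht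
  have hcont : ContinuousOn (Function.uncurry
      fun (t : ℝ) (y : EuclideanSpace ℝ (Fin 3)) => t * f (x + t • (y - x)))
      (Icc (0 : ℝ) 1 ×ˢ B) := by
    refine continuousOn_fst.mul (hf.comp (f := fun z : ℝ × EuclideanSpace ℝ (Fin 3) =>
      x + z.1 • (z.2 - x)) (by fun_prop) ?_)
    rintro ⟨t, y⟩ ⟨ht, hy⟩
    exact hmaps t ht y hy
  have h_int : Integrable (Function.uncurry
      fun (t : ℝ) (y : EuclideanSpace ℝ (Fin 3)) => t * f (x + t • (y - x)))
      ((volume.restrict (uIoc (0 : ℝ) 1)).prod (volume.restrict B)) := by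
    rw [uIoc_of_le zero_le_one, Measure.prod_restrict]
    exact (hcont.integrableOn_compact (isCompact_Icc.prod hBc)).mono_set
      (prod_mono Ioc_subset_Icc_self subset_rfl)
  have h_int' := h_int
  rw [uIoc_of_le zero_le_one] at h_int'
  constructor
  · have := h_int'.integral_prod_right
    simp only [Function.uncurry] at this
    simp only [intervalIntegral.integral_of_le zero_le_one]
    exact this
  rw [← intervalIntegral_integral_swap h_int]
  set K := √(volume.real B) * √(∫ z in T, f z ^ 2)
  have hval : ∫ t in (0 : ℝ)..1, t ^ (-(1 / 2) : ℝ) * K = 2 * K := by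
    rw [intervalIntegral.integral_mul_const, integral_rpow (Or.inl (by norm_num))]
    norm_num
  rw [← hval, intervalIntegral.integral_of_le zero_le_one, intervalIntegral.integral_of_le zero_le_one]
  refine setIntegral_mono_on h_int'.integral_prod_left ?_ measurableSet_Ioc fun t ht => ?_
  · rw [← intervalIntegrable_iff_integrableOn_Ioc_of_le zero_le_one]
    exact (intervalIntegral.intervalIntegrable_rpow' (by norm_num)).mul_const K
  · have hct : ContinuousOn (fun y => f (x + t • (y - x))) B :=
      hf.comp (by fun_prop) (hmaps t (Ioc_subset_Icc_self ht))
    have ht0 : 0 < t := ht.1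
    have h1 := setIntegral_le_sqrt_mul_sqrt (hBc.measure_lt_top (μ := volume)).ne
      (hct.integrableOn_compact hBc) ((hct.pow 2).integrableOn_compact hBc)
    have h2 := setIntegral_comp_add_smul_sub_le (μ := volume) hTc.measurableSet hBc.measurableSet
      ((hf.pow 2).integrableOn_compact hTc) (fun z => sq_nonneg (f z)) ht0
      (hmaps t (Ioc_subset_Icc_self ht))
    rw [finrank_euclideanSpace_fin] at h2
    have h3 : √(∫ y in B, f (x + t • (y - x)) ^ 2) ≤
        √((t ^ 3)⁻¹) * √(∫ z in T, f z ^ 2) := by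
      rw [← Real.sqrt_mul (by positivity)]
      exact Real.sqrt_le_sqrt h2
    have h4 : t * √((t ^ 3)⁻¹) = t ^ (-(1 / 2) : ℝ) := by
      rw [Real.sqrt_eq_rpow, ← Real.rpow_natCast, ← Real.rpow_neg ht0.le, ← Real.rpow_mul ht0.le]
      nth_rewrite 1 [← Real.rpow_one t]
      rw [← Real.rpow_add ht0]
      norm_num
    rw [integral_const_mul]
    calc t * ∫ y in B, f (x + t • (y - x))
        ≤ t * (√(volume.real B) * (√((t ^ 3)⁻¹) * √(∫ z in T, f z ^ 2))) := by
          refine mul_le_mul_of_nonneg_left (h1.trans ?_) ht0.le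
          exact mul_le_mul_of_nonneg_left h3 (Real.sqrt_nonneg _)
      _ = t ^ (-(1 / 2) : ℝ) * K := by rw [← h4]; ring

/-- The Sobolev embedding `H² ⊆ C⁰` on a compact convex set containing a ball, with the dependence
of the constant on the ball made explicit. -/
lemma sqrt_volume_mul_abs_le {T : Set (EuclideanSpace ℝ (Fin 3))} (hTc : IsCompact T)
    (hTconv : Convex ℝ T) {u : EuclideanSpace ℝ (Fin 3) → ℝ} {U : Set (EuclideanSpace ℝ (Fin 3))}
    (hU : IsOpen U) (hTU : T ⊆ U) (hu : ContDiffOn ℝ 2 u U) {c : EuclideanSpace ℝ (Fin 3)} {r : ℝ}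
    (hr : 0 < r) (hB : Metric.closedBall c r ⊆ T) {x : EuclideanSpace ℝ (Fin 3)} (hx : x ∈ T) :
    √(volume.real (Metric.closedBall c r)) * |u x| ≤
      L2norm T u + Metric.diam T * H1seminorm T u + 2 * Metric.diam T ^ 2 * H2seminorm T u := by
  set B := Metric.closedBall c r with hBdef
  set h := Metric.diam T
  have hh : 0 ≤ h := Metric.diam_nonneg
  have hBc : IsCompact B := isCompact_closedBall c r
  have hBm : MeasurableSet B := hBc.measurableSet
  have hBfin : volume B ≠ ⊤ := hBc.measure_lt_top.ne
  have hV : 0 < volume.real B :=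
    ENNReal.toReal_pos (Metric.measure_closedBall_pos volume c hr).ne' hBfin
  set D₁ : EuclideanSpace ℝ (Fin 3) → ℝ :=
    fun y => √(∑ i, fderiv ℝ u y (EuclideanSpace.single i 1) ^ 2)
  set D₂ : EuclideanSpace ℝ (Fin 3) → ℝ := fun y => √(∑ i, ∑ j,
    fderiv ℝ (fderiv ℝ u) y (EuclideanSpace.single i 1) (EuclideanSpace.single j 1) ^ 2)
  have hcu : ContinuousOn u T := hu.continuousOn.mono hTU
  have hu1 : ContDiffOn ℝ 1 (fderiv ℝ u) U := hu.fderiv_of_isOpen hU (by norm_num)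
  have hc1 (i : Fin 3) : ContinuousOn (fun y => fderiv ℝ u y (EuclideanSpace.single i 1) ^ 2) T :=
    ((hu1.continuousOn.mono hTU).clm_apply continuousOn_const).pow 2
  have hc2 (i j : Fin 3) : ContinuousOn (fun y => fderiv ℝ (fderiv ℝ u) y
      (EuclideanSpace.single i 1) (EuclideanSpace.single j 1) ^ 2) T :=
    ((((hu1.continuousOn_fderiv_of_isOpen hU le_rfl).mono hTU).clm_apply
      continuousOn_const).clm_apply continuousOn_const).pow 2
  have hcD₁ : ContinuousOn D₁ T := (continuousOn_finsetSum _ fun i _ => hc1 i).sqrt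
  have hcD₂ : ContinuousOn D₂ T :=
    (continuousOn_finsetSum _ fun i _ => continuousOn_finsetSum _ fun j _ => hc2 i j).sqrt
  have hH1 : √(∫ y in T, D₁ y ^ 2) = H1seminorm T u := by
    have : ∀ y, D₁ y ^ 2 = ∑ i, fderiv ℝ u y (EuclideanSpace.single i 1) ^ 2 := fun y =>
      Real.sq_sqrt (Finset.sum_nonneg fun _ _ => sq_nonneg _)
    simp_rw [this]
    rw [integral_finsetSum _ fun i _ => (hc1 i).integrableOn_compact hTc, H1seminorm]
  have hH2 : √(∫ y in T, D₂ y ^ 2) = H2seminorm T u := by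
    have : ∀ y, D₂ y ^ 2 = ∑ i, ∑ j, fderiv ℝ (fderiv ℝ u) y (EuclideanSpace.single i 1)
        (EuclideanSpace.single j 1) ^ 2 := fun y =>
      Real.sq_sqrt (Finset.sum_nonneg fun _ _ => Finset.sum_nonneg fun _ _ => sq_nonneg _)
    simp_rw [this]
    rw [integral_finsetSum _ fun i _ =>
      (continuousOn_finsetSum _ fun j _ => hc2 i j).integrableOn_compact hTc]
    simp_rw [integral_finsetSum _ fun j _ => (hc2 _ j).integrableOn_compact hTc]
    simp [H2seminorm, iteratedFDeriv_two_apply]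
  have hball {f : EuclideanSpace ℝ (Fin 3) → ℝ} (hf : ContinuousOn f T) :
      ∫ y in B, f y ≤ √(volume.real B) * √(∫ y in T, f y ^ 2) := by
    refine (setIntegral_le_sqrt_mul_sqrt hBfin ((hf.mono hB).integrableOn_compact hBc)
      (((hf.mono hB).pow 2).integrableOn_compact hBc)).trans ?_
    refine mul_le_mul_of_nonneg_left (Real.sqrt_le_sqrt ?_) (Real.sqrt_nonneg _)
    exact setIntegral_mono_set ((hf.pow 2).integrableOn_compact hTc)
      (Filter.Eventually.of_forall fun y => sq_nonneg (f y)) hB.eventuallyLE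
  obtain ⟨hci, hcone⟩ := integral_integral_cone_le hTc hTconv hcD₂ hBc hB hx
  have hpt : ∀ y ∈ B, |u x| ≤ |u y| + h * D₁ y +
      h ^ 2 * ∫ t in (0 : ℝ)..1, t * D₂ (x + t • (y - x)) := by
    intro y hy
    have hmem : ∀ t ∈ Icc (0 : ℝ) 1, x + t • (y - x) ∈ T := fun t ht =>
      hTconv.add_smul_sub_mem hx (hB hy) ht
    have hn : ‖y - x‖ ≤ h := by
      rw [← dist_eq_norm]
      exact Metric.dist_le_diam_of_mem hTc.isBounded (hB hy) hx
    have h1 : |fderiv ℝ u y (y - x)| ≤ h * D₁ y := by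
      rw [mul_comm]
      exact (abs_apply_le_sqrt_sum_sq_mul _ _).trans
        (mul_le_mul_of_nonneg_left hn (Real.sqrt_nonneg _))
    have h_int : IntervalIntegrable (fun t : ℝ => h ^ 2 * (t * D₂ (x + t • (y - x)))) volume 0 1 := by
      refine ContinuousOn.intervalIntegrable ?_
      rw [uIcc_of_le zero_le_one]
      exact continuousOn_const.mul (continuousOn_id.mul (hcD₂.comp (by fun_prop) hmem))
    have h2 : |∫ t in (0 : ℝ)..1, t * fderiv ℝ (fderiv ℝ u) (x + t • (y - x)) (y - x) (y - x)| ≤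
        h ^ 2 * ∫ t in (0 : ℝ)..1, t * D₂ (x + t • (y - x)) := by
      rw [← intervalIntegral.integral_const_mul, ← Real.norm_eq_abs]
      refine intervalIntegral.norm_integral_le_of_norm_le zero_le_one
        (Filter.Eventually.of_forall fun t ht => ?_) h_int
      have h3 := abs_apply_apply_le_sqrt_sum_sq_mul
        (fderiv ℝ (fderiv ℝ u) (x + t • (y - x))) (y - x)
      have h4 : ‖y - x‖ ^ 2 ≤ h ^ 2 := pow_le_pow_left₀ (norm_nonneg _) hn 2
      rw [Real.norm_eq_abs, abs_mul, abs_of_pos ht.1]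
      calc t * |fderiv ℝ (fderiv ℝ u) (x + t • (y - x)) (y - x) (y - x)|
          ≤ t * (D₂ (x + t • (y - x)) * h ^ 2) := by
            refine mul_le_mul_of_nonneg_left (h3.trans ?_) ht.1.le
            exact mul_le_mul_of_nonneg_left h4 (Real.sqrt_nonneg _)
        _ = h ^ 2 * (t * D₂ (x + t • (y - x))) := by ring
    rw [hu.eq_sub_add_integral_fderiv_fderiv hU fun t ht => hTU (hmem t ht)]
    refine (abs_add_le _ _).trans (add_le_add ((abs_sub _ _).trans ?_) h2)
    exact add_le_add le_rfl h1
  have hi0 : IntegrableOn (fun y => |u y|) B := (hcu.abs.mono hB).integrableOn_compact hBc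
  have hi1 : IntegrableOn (fun y => h * D₁ y) B :=
    ((hcD₁.mono hB).integrableOn_compact hBc).const_mul h
  have hi2 := hci.const_mul (h ^ 2)
  have hi01 : IntegrableOn (fun y => |u y| + h * D₁ y) B := hi0.add hi1
  have hmain := setIntegral_mono_on (integrableOn_const (C := |u x|) hBfin) (hi01.add hi2) hBm hpt
  rw [setIntegral_const, smul_eq_mul] at hmain
  have hsplit : ∫ y in B, (|u y| + h * D₁ y +
      h ^ 2 * ∫ t in (0 : ℝ)..1, t * D₂ (x + t • (y - x))) =
      (∫ y in B, |u y|) + h * (∫ y in B, D₁ y) +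
        h ^ 2 * ∫ y in B, ∫ t in (0 : ℝ)..1, t * D₂ (x + t • (y - x)) := by
    rw [integral_add hi01 hi2, integral_add hi0 hi1, integral_const_mul, integral_const_mul]
  have h0 := hball hcu.abs
  have h1 := mul_le_mul_of_nonneg_left (hball hcD₁) hh
  have h2 := mul_le_mul_of_nonneg_left hcone (sq_nonneg h)
  simp only [sq_abs] at h0
  rw [hH1] at h1
  rw [hH2] at h2
  have hL2 : √(∫ y in T, u y ^ 2) = L2norm T u := rfl
  rw [hL2] at h0
  set s := √(volume.real B)
  have hs : 0 < s := Real.sqrt_pos.2 hV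
  have hss : volume.real B = s * s := (Real.mul_self_sqrt hV.le).symm
  have hfin : s * (s * |u x|) ≤
      s * (L2norm T u + h * H1seminorm T u + 2 * h ^ 2 * H2seminorm T u) := by
    rw [← mul_assoc, ← hss]
    calc volume.real B * |u x| ≤ _ := hmain
      _ = _ := hsplit
      _ ≤ _ := by linarith
  exact le_of_mul_le_mul_left hfin hs

/-- A nondegenerate simplex contains a ball of radius comparable to its inradius. -/
lemma exists_closedBall_subset_convexHull {p : Fin 4 → EuclideanSpace ℝ (Fin 3)}
    (hp : AffineIndependent ℝ p) {ρ : ℝ}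
    (hρ : Metric.diam (convexHull ℝ (range p)) / inradius (convexHull ℝ (range p)) ≤ ρ) :
    ∃ c r, 0 < r ∧ Metric.closedBall c r ⊆ convexHull ℝ (range p) ∧
      Metric.diam (convexHull ℝ (range p)) ≤ 2 * ρ * r := by
  set T := convexHull ℝ (range p)
  have hTc : IsCompact T := (finite_range p).isCompact_convexHull ℝ
  have hbdd : BddAbove {s : ℝ | ∃ c, Metric.closedBall c s ⊆ T} := by
    refine ⟨Metric.diam T, ?_⟩
    rintro s ⟨c, hc⟩
    rcases le_or_gt s 0 with hs | hs
    · exact hs.trans Metric.diam_nonneg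
    · have := Metric.dist_le_diam_of_mem hTc.isBounded
        (hc (show c + EuclideanSpace.single 0 s ∈ _ by simp [abs_of_pos hs]))
        (hc (Metric.mem_closedBall_self hs.le))
      simpa [abs_of_pos hs] using this
  have h_int : (interior T).Nonempty := by
    rw [interior_convexHull_nonempty_iff_affineSpan_eq_top,
      hp.affineSpan_eq_top_iff_card_eq_finrank_add_one, finrank_euclideanSpace_fin,
      Fintype.card_fin]
  obtain ⟨c₀, hc₀⟩ := h_int
  obtain ⟨ε, hε, hball⟩ := Metric.nhds_basis_closedBall.mem_iff.1 (mem_interior_iff_mem_nhds.1 hc₀)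
  have hpos : 0 < inradius T := hε.trans_le (le_csSup hbdd ⟨c₀, hball⟩)
  have hne : {s : ℝ | ∃ c, Metric.closedBall c s ⊆ T}.Nonempty := ⟨ε, c₀, hball⟩
  obtain ⟨r, ⟨c, hc⟩, hr⟩ := exists_lt_of_lt_csSup hne (half_lt_self hpos)
  have hr0 : 0 < r := (half_pos hpos).trans hr
  have hρ0 : 0 ≤ ρ := (div_nonneg Metric.diam_nonneg hpos.le).trans hρ
  refine ⟨c, r, hr0, hc, ?_⟩
  rw [div_le_iff₀ hpos] at hρ
  have hr' : inradius T / 2 < r := hr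
  nlinarith

/-- An affine function bounded by `m` on a set containing a ball of radius `r` has slope at most
`m / r`. -/
lemma abs_linear_le_of_abs_le_on_closedBall {E : Type*} [NormedAddCommGroup E] [NormedSpace ℝ E]
    (w : E →ᵃ[ℝ] ℝ) {c : E} {r m : ℝ} (hr : 0 < r)
    (hw : ∀ y ∈ Metric.closedBall c r, |w y| ≤ m) {v : E} (hv : ‖v‖ ≤ 1) :
    |w.linear v| ≤ m / r := by
  have hp : c + r • v ∈ Metric.closedBall c r := by
    simpa [norm_smul, abs_of_pos hr] using mul_le_of_le_one_right hr.le hv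
  have hm : c - r • v ∈ Metric.closedBall c r := by
    simpa [norm_smul, abs_of_pos hr, dist_eq_norm] using mul_le_of_le_one_right hr.le hv
  have h := w.linearMap_vsub (c + r • v) (c - r • v)
  have h2 : (c + r • v) -ᵥ (c - r • v) = (2 * r) • v := by
    rw [vsub_eq_sub, mul_smul, two_smul]; abel
  rw [h2, map_smul, vsub_eq_sub, smul_eq_mul] at h
  have h3 := abs_sub (w (c + r • v)) (w (c - r • v))
  rw [← h, abs_mul, abs_of_pos (by positivity)] at h3
  rw [le_div_iff₀ hr]
  linarith [hw _ hp, hw _ hm]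

/-- `H¹` stability of the quasi-interpolant
`Du = Σᵢ (Π_{σᵢ}u)(pᵢ) λᵢ` on a shape-regular tetrahedron (`h/r ≤ ρ`, `h` the
diameter, `r` the inradius), with edges `σᵢ` of `T` emanating from the vertices `pᵢ`:
`|Du|_{H¹(T)} ≤ C h⁻¹ (‖u‖_{L²(T)} + h |u|_{H¹(T)} + h² |u|_{H²(T)})`,
where `C` depends only on `ρ`. -/
theorem quasi_interpolant_H1_stability :
    ∀ ρ : ℝ, 1 ≤ ρ →
    ∃ C : ℝ, 0 < C ∧
      ∀ p : Fin 4 → EuclideanSpace ℝ (Fin 3), AffineIndependent ℝ p →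
      ∀ T : Set (EuclideanSpace ℝ (Fin 3)), T = convexHull ℝ (range p) →
      Metric.diam T / inradius T ≤ ρ →
      ∀ e : Fin 4 → Fin 4, (∀ i, e i ≠ i) →
      ∀ lam : Fin 4 → (EuclideanSpace ℝ (Fin 3) →ᵃ[ℝ] ℝ),
        (∀ i j, lam i (p j) = if i = j then 1 else 0) →
      ∀ u : EuclideanSpace ℝ (Fin 3) → ℝ,
        (∃ U : Set (EuclideanSpace ℝ (Fin 3)), IsOpen U ∧ closure T ⊆ U ∧
          ContDiffOn ℝ 2 u U) →
      ∀ g : Fin 4 → (EuclideanSpace ℝ (Fin 3) →ᵃ[ℝ] ℝ),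
        (∀ i, ∀ g' : EuclideanSpace ℝ (Fin 3) →ᵃ[ℝ] ℝ,
          (∫ x in segment ℝ (p i) (p (e i)), (u x - g i x) ^ 2 ∂μH[1]) ≤
            ∫ x in segment ℝ (p i) (p (e i)), (u x - g' x) ^ 2 ∂μH[1]) →
      H1seminorm T (fun x => ∑ i : Fin 4, g i (p i) * lam i x) ≤
        C * (Metric.diam T)⁻¹ * (L2norm T u + Metric.diam T * H1seminorm T u +
          Metric.diam T ^ 2 * H2seminorm T u) := by
  intro ρ hρ1
  refine ⟨14 * (2 * ρ) ^ 3, by positivity, ?_⟩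
  rintro p hp T hT hρ e he lam hlam u ⟨U, hU, hTU, hu⟩ g hg
  subst hT
  obtain ⟨c, r, hr, hB, hdiam⟩ := exists_closedBall_subset_convexHull hp hρ
  set T := convexHull ℝ (range p) with hTdef
  have hTc : IsCompact T := (finite_range p).isCompact_convexHull ℝ
  have hTconv : Convex ℝ T := convex_convexHull ℝ _
  have hpT (i : Fin 4) : p i ∈ T := subset_convexHull ℝ _ (mem_range_self i)
  have hTU' : T ⊆ U := subset_closure.trans hTU
  set K := 2 * ρ with hK
  have hK1 : 1 ≤ K := by linarith
  set h := Metric.diam T with hh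
  have hh0 : 0 < h := by
    have h01 : p 0 ≠ p 1 := fun h => by simpa using hp.injective h
    exact (dist_pos.2 h01).trans_le (Metric.dist_le_diam_of_mem hTc.isBounded (hpT 0) (hpT 1))
  set V := volume.real (Metric.closedBall c r) with hVdef
  have hVeq : V = r ^ 3 * volume.real (Metric.ball (0 : EuclideanSpace ℝ (Fin 3)) 1) := by
    rw [hVdef, Measure.addHaar_real_closedBall _ _ hr.le, finrank_euclideanSpace_fin]
  have hV : 0 < V := ENNReal.toReal_pos (Metric.measure_closedBall_pos volume c hr).ne'
    (isCompact_closedBall c r).measure_lt_top.ne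
  set N := L2norm T u + h * H1seminorm T u + 2 * h ^ 2 * H2seminorm T u with hN
  have hN1 : N ≤ 2 * (L2norm T u + h * H1seminorm T u + h ^ 2 * H2seminorm T u) := by
    have h1 : 0 ≤ L2norm T u := Real.sqrt_nonneg _
    have h2 : 0 ≤ h * H1seminorm T u := mul_nonneg hh0.le (Real.sqrt_nonneg _)
    linarith
  have hN0 : 0 ≤ N := by
    have h1 : 0 ≤ L2norm T u := Real.sqrt_nonneg _
    have h2 : 0 ≤ H1seminorm T u := Real.sqrt_nonneg _
    have h3 : 0 ≤ H2seminorm T u := Real.sqrt_nonneg _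
    positivity
  have hs : 0 < √V := Real.sqrt_pos.2 hV
  set M := N / √V with hM
  have hM0 : 0 ≤ M := by positivity
  have huM : ∀ x ∈ T, |u x| ≤ M := fun x hx => by
    rw [hM, le_div_iff₀ hs, mul_comm]
    exact sqrt_volume_mul_abs_le hTc hTconv hU hTU' hu hr hB hx
  have hgM (i : Fin 4) : |g i (p i)| ≤ 4 * M := by
    have hseg : segment ℝ (p i) (p (e i)) ⊆ T := hTconv.segment_subset (hpT _) (hpT _)
    exact abs_le_of_segment_leastSquares (fun h => he i (hp.injective h)) hM0
      ((hu.continuousOn.mono hTU').mono hseg) (fun x hx => huM x (hseg hx)) (g i) (hg i 0)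
  set w : EuclideanSpace ℝ (Fin 3) →ᵃ[ℝ] ℝ := ∑ i, g i (p i) • lam i with hw
  have hwfun (x : EuclideanSpace ℝ (Fin 3)) : ∑ i, g i (p i) * lam i x = w x := by
    simp [hw, Fin.sum_univ_four]
  have hwT : ∀ x ∈ T, |w x| ≤ 4 * M := by
    have hconv : Convex ℝ (w ⁻¹' Icc (-(4 * M)) (4 * M)) := (convex_Icc _ _).affine_preimage w
    have hsub : range p ⊆ w ⁻¹' Icc (-(4 * M)) (4 * M) := by
      rintro _ ⟨j, rfl⟩
      rw [mem_preimage, ← hwfun]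
      simpa [hlam] using abs_le.1 (hgM j)
    exact fun x hx => abs_le.2 (convexHull_min hsub hconv hx)
  have hgrad (x : EuclideanSpace ℝ (Fin 3)) (i : Fin 3) :
      fderiv ℝ (fun x => ∑ i, g i (p i) * lam i x) x (EuclideanSpace.single i 1) ^ 2 ≤
        (4 * M / r) ^ 2 := by
    have hfd : HasFDerivAt (fun x => ∑ i, g i (p i) * lam i x)
        (LinearMap.toContinuousLinearMap w.linear) x := by
      have hdec : (fun x => ∑ i, g i (p i) * lam i x) = fun x => w.linear x + w 0 := by
        funext x
        rw [hwfun, w.decomp]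
        simp
      rw [hdec]
      exact (LinearMap.toContinuousLinearMap w.linear).hasFDerivAt.add_const _
    rw [hfd.fderiv]
    refine sq_le_sq' (abs_le.1 ?_).1 (abs_le.1 ?_).2 <;>
    exact abs_linear_le_of_abs_le_on_closedBall w hr (fun y hy => hwT y (hB hy)) (by simp)
  have hvol : volume.real T ≤ K ^ 3 * V := by
    have hsub : T ⊆ Metric.closedBall (p 0) h := fun x hx =>
      Metric.dist_le_diam_of_mem hTc.isBounded hx (hpT 0)
    calc volume.real T ≤ volume.real (Metric.closedBall (p 0) h) :=
          measureReal_mono hsub (isCompact_closedBall _ _).measure_lt_top.ne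
      _ = h ^ 3 * volume.real (Metric.ball (0 : EuclideanSpace ℝ (Fin 3)) 1) := by
          rw [Measure.addHaar_real_closedBall _ _ hh0.le, finrank_euclideanSpace_fin]
      _ ≤ (K * r) ^ 3 * volume.real (Metric.ball (0 : EuclideanSpace ℝ (Fin 3)) 1) := by
          gcongr
      _ = K ^ 3 * V := by rw [hVeq]; ring
  have hconst : IntegrableOn (fun _ : EuclideanSpace ℝ (Fin 3) => (4 * M / r) ^ 2) T :=
    integrableOn_const hTc.measure_lt_top.ne
  have h_int (i : Fin 3) : ∫ x in T,
      fderiv ℝ (fun x => ∑ i, g i (p i) * lam i x) x (EuclideanSpace.single i 1) ^ 2 ≤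
        K ^ 3 * V * (4 * M / r) ^ 2 := by
    calc _ ≤ ∫ _ in T, (4 * M / r) ^ 2 :=
          integral_mono_of_nonneg (Filter.Eventually.of_forall fun x => sq_nonneg _)
            hconst
            (Filter.Eventually.of_forall fun x => hgrad x i)
      _ = volume.real T * (4 * M / r) ^ 2 := by rw [setIntegral_const, smul_eq_mul]
      _ ≤ _ := by gcongr
  have hVM : V * M ^ 2 = N ^ 2 := by
    rw [hM, div_pow, Real.sq_sqrt hV.le]; field_simp
  have hrh : 1 / r ≤ K / h := by
    rw [div_le_div_iff₀ hr hh0]; linarith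
  have hbound : H1seminorm T (fun x => ∑ i, g i (p i) * lam i x) ≤ 7 * K ^ 3 * N * h⁻¹ := by
    refine Real.sqrt_le_iff.2 ⟨by positivity, ?_⟩
    calc _ ≤ ∑ _i : Fin 3, K ^ 3 * V * (4 * M / r) ^ 2 := Finset.sum_le_sum fun i _ => h_int i
      _ = 48 * K ^ 3 * (V * M ^ 2) * (1 / r) ^ 2 := by
          rw [Finset.sum_const, Finset.card_univ, Fintype.card_fin, nsmul_eq_mul]
          push_cast
          ring
      _ ≤ 48 * K ^ 3 * N ^ 2 * (K / h) ^ 2 := by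
          rw [hVM]; gcongr
      _ = 48 * K ^ 5 * N ^ 2 * (h⁻¹) ^ 2 := by ring
      _ ≤ 49 * K ^ 6 * N ^ 2 * (h⁻¹) ^ 2 := by
          have : K ^ 5 ≤ K ^ 6 := pow_le_pow_right₀ hK1 (by norm_num)
          gcongr
          norm_num
      _ = (7 * K ^ 3 * N * h⁻¹) ^ 2 := by ring
  calc _ ≤ 7 * K ^ 3 * N * h⁻¹ := hbound
    _ ≤ 7 * K ^ 3 * (2 * (L2norm T u + h * H1seminorm T u + h ^ 2 * H2seminorm T u)) * h⁻¹ := by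
        gcongr
    _ = _ := by ring
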